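/- Let r ∈ (0,1) and L, α > 0. There exists a constant C > 0 (depending on d, r, L, α) such that the following holds. Set a_n = (C·ln(n)/n)^{1/α} and b_n = n^{−1/α}, and set τ_α = 1 if α ≥ 1 and τ_α = 2^{α−1} if 0 < α < 1. Let G ⊆ ℝ^d be a convex body contained in the closed unit ball B(0,1), and let μ be a probability measure on ℝ^d with μ(G) = 1 satisfying: for all u ∈ S^{d-1} and all t ∈ [0,r], μ(C_G(u,t)) ≥ L·t^α. Let X_1, …, X_n be i.i.d. with distribution μ and let K̂_n be their convex hull. Then for every x ≥ 0 with a_n + b_n·x ≤ r, one has d_H(K̂_n, G) ≤ 2a_n + 2b_n·x with probability at least 1 − 12^d·exp(−τ_α·L·x^α). -/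

import Mathlib

open Metric Set Classical
open scoped RealInnerProductSpace

noncomputable section

abbrev Euc (d : ℕ) := EuclideanSpace ℝ (Fin d)

/-- The support function of a set `G`: `h_G(u) = sup {⟨u,x⟩ : x ∈ G}`. -/
def suppFn {d : ℕ} (G : Set (Euc d)) (u : Euc d) : ℝ :=
  sSup ((fun x => ⟪u, x⟫) '' G)

/-- The positively homogeneous extension of a function defined (at least) on the unit sphere. -/

def homExt {d : ℕ} (φ : Euc d → ℝ) (v : Euc d) : ℝ :=
  if v = 0 then 0 else ‖v‖ * φ (‖v‖⁻¹ • v)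

/-- `φ` is subadditive: its positively homogeneous extension is convex on `ℝ^d`. -/
def IsSubadditiveFn {d : ℕ} (φ : Euc d → ℝ) : Prop :=
  ConvexOn ℝ Set.univ (homExt φ)

/-- The convex set defined by the affine constraints `⟨u,x⟩ ≤ φ(u)` for all `u ∈ S^{d-1}`. -/
def Gphi {d : ℕ} (φ : Euc d → ℝ) : Set (Euc d) :=
  {x | ∀ u ∈ sphere (0 : Euc d) 1, ⟪u, x⟫ ≤ φ u}

open MeasureTheory

/-- The cap of `G` in direction `u` with height `t`. -/
def cap {d : ℕ} (G : Set (Euc d)) (u : Euc d) (t : ℝ) : Set (Euc d) :=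
  {x ∈ G | suppFn G u - t ≤ ⟪u, x⟫}

/-- A separated finite subset of the unit ball satisfies the volumetric cardinality bound. -/
lemma card_le_of_separated_of_norm_le_one {d : ℕ} {δ : ℝ} (hδ : 0 < δ) (s : Finset (Euc d))
    (hs : ∀ c ∈ s, ‖c‖ ≤ 1) (hsep : ∀ c ∈ s, ∀ e ∈ s, c ≠ e → δ ≤ ‖c - e‖) :
    (s.card : ℝ) ≤ (1 + 2 / δ) ^ d := by
  have hD : Set.Pairwise (s : Set (Euc d))
      (Function.onFun Disjoint fun c => ball c (δ / 2)) := by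
    intro c hc e he hce
    apply ball_disjoint_ball
    rw [dist_eq_norm, add_halves]
    exact hsep c hc e he hce
  have hsub : (⋃ c ∈ s, ball (c : Euc d) (δ / 2)) ⊆ ball (0 : Euc d) (1 + δ / 2) := by
    refine iUnion₂_subset fun x hx => ball_subset_ball' ?_
    rw [dist_zero_right]
    linarith [hs x hx]
  have hvol : (s.card : ENNReal) * ENNReal.ofReal ((δ / 2) ^ d) * volume (ball (0 : Euc d) 1) ≤
      ENNReal.ofReal ((1 + δ / 2) ^ d) * volume (ball (0 : Euc d) 1) := by
    have h := measure_mono (μ := (volume : Measure (Euc d))) hsub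
    rw [measure_biUnion_finset hD fun c _ => measurableSet_ball,
      Measure.addHaar_ball_of_pos _ _ (by positivity : 0 < 1 + δ / 2)] at h
    simpa [Measure.addHaar_ball_of_pos _ _ (by positivity : 0 < δ / 2), mul_assoc] using h
  have hcard : (s.card : ENNReal) * ENNReal.ofReal ((δ / 2) ^ d) ≤
      ENNReal.ofReal ((1 + δ / 2) ^ d) :=
    (ENNReal.mul_le_mul_iff_left (measure_ball_pos _ _ zero_lt_one).ne'
      measure_ball_lt_top.ne).1 hvol
  have h := ENNReal.toReal_le_of_le_ofReal (by positivity) hcard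
  rw [ENNReal.toReal_mul, ENNReal.toReal_natCast,
    ENNReal.toReal_ofReal (by positivity), ← le_div_iff₀ (by positivity), ← div_pow] at h
  refine h.trans_eq (congrArg (· ^ d) ?_)
  field_simp
  ring

/-- The unit sphere admits a finite `δ`-net of cardinality at most `(1 + 2 / δ) ^ d`. -/
lemma exists_sphere_net (d : ℕ) {δ : ℝ} (hδ : 0 < δ) :
    ∃ s : Finset (Euc d), (∀ u ∈ s, u ∈ sphere (0 : Euc d) 1) ∧
      (∀ v ∈ sphere (0 : Euc d) 1, ∃ u ∈ s, ‖v - u‖ ≤ δ) ∧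
      (s.card : ℝ) ≤ (1 + 2 / δ) ^ d := by
  let S : Set ℕ := {k | ∃ s : Finset (Euc d), (∀ u ∈ s, u ∈ sphere (0 : Euc d) 1) ∧
    (∀ c ∈ s, ∀ e ∈ s, c ≠ e → δ ≤ ‖c - e‖) ∧ s.card = k}
  have hbound : ∀ s : Finset (Euc d), (∀ u ∈ s, u ∈ sphere (0 : Euc d) 1) →
      (∀ c ∈ s, ∀ e ∈ s, c ≠ e → δ ≤ ‖c - e‖) → (s.card : ℝ) ≤ (1 + 2 / δ) ^ d :=
    fun s hs hsep => card_le_of_separated_of_norm_le_one hδ s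
      (fun c hc => (mem_sphere_zero_iff_norm.1 (hs c hc)).le) hsep
  have hS : BddAbove S := by
    refine ⟨⌊(1 + 2 / δ) ^ d⌋₊, ?_⟩
    rintro k ⟨s, hs, hsep, rfl⟩
    exact Nat.le_floor (hbound s hs hsep)
  obtain ⟨s, hs, hsep, hcard⟩ : sSup S ∈ S := Nat.sSup_mem ⟨0, ∅, by simp⟩ hS
  refine ⟨s, hs, fun v hv => ?_, hbound s hs hsep⟩
  by_contra! hfar
  have hv' : v ∉ s := fun h => by
    have := hfar v h
    rw [sub_self, norm_zero] at this
    linarith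
  have hmem : (insert v s).card ∈ S := by
    refine ⟨insert v s, ?_, ?_, rfl⟩
    · intro u hu
      rcases Finset.mem_insert.1 hu with rfl | hu
      · exact hv
      · exact hs u hu
    · intro c hc e he hce
      rcases Finset.mem_insert.1 hc with rfl | hc' <;>
        rcases Finset.mem_insert.1 he with rfl | he'
      · exact absurd rfl hce
      · exact (hfar e he').le
      · rw [norm_sub_rev]
        exact (hfar c hc').le
      · exact hsep c hc' e he' hce
  have hle := le_csSup hS hmem
  rw [Finset.card_insert_of_notMem hv', hcard] at hle
  omega

lemma inner_le_suppFn {d : ℕ} {G : Set (Euc d)} (hG : IsCompact G) (u : Euc d) {y : Euc d}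
    (hy : y ∈ G) : ⟪u, y⟫ ≤ suppFn G u :=
  le_csSup (hG.image (continuous_const.inner continuous_id)).bddAbove ⟨y, hy, rfl⟩

lemma isClosed_cap {d : ℕ} {G : Set (Euc d)} (hG : IsCompact G) (u : Euc d) (t : ℝ) :
    IsClosed (cap G u t) :=
  hG.isClosed.inter (isClosed_le (f := fun _ => suppFn G u - t) (g := fun x => ⟪u, x⟫)
    continuous_const (continuous_const.inner continuous_id))

/-- If a finite family in `G` hits the caps of height `ε` in all directions of an `ε / 2`-net of the
sphere, then its convex hull is within Hausdorff distance `2 * ε` of `G`. -/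
lemma hausdorffDist_convexHull_le_of_hits_caps {d : ℕ} {ι : Type*} [Finite ι] [Nonempty ι]
    {G : Set (Euc d)} (hG : IsCompact G) (hconv : Convex ℝ G) (hball : G ⊆ closedBall 0 1)
    {ε : ℝ} (hε : 0 < ε) (s : Finset (Euc d))
    (hs : ∀ v ∈ sphere (0 : Euc d) 1, ∃ u ∈ s, ‖v - u‖ ≤ ε / 2)
    (X : ι → Euc d) (hX : ∀ i, X i ∈ G) (hhit : ∀ u ∈ s, ∃ i, X i ∈ cap G u ε) :
    hausdorffDist (convexHull ℝ (Set.range X)) G ≤ 2 * ε := by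
  have hsub : convexHull ℝ (Set.range X) ⊆ G :=
    convexHull_min (Set.range_subset_iff.2 hX) hconv
  refine hausdorffDist_le_of_mem_dist (by positivity)
    (fun y hy => ⟨y, hsub hy, by rw [dist_self]; positivity⟩) fun y hy => ?_
  obtain ⟨p, hp, hmin⟩ := exists_norm_eq_iInf_of_complete_convex
    (convexHull_nonempty_iff.2 (Set.range_nonempty X))
    ((Set.finite_range X).isCompact_convexHull ℝ).isComplete (convex_convexHull ℝ _) y
  rw [norm_eq_iInf_iff_real_inner_le_zero (convex_convexHull ℝ _) hp] at hmin
  refine ⟨p, hp, ?_⟩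
  rw [dist_eq_norm]
  rcases eq_or_ne y p with rfl | hne
  · rw [sub_self, norm_zero]
    positivity
  have hpos : 0 < ‖y - p‖ := norm_pos_iff.2 (sub_ne_zero.2 hne)
  set v : Euc d := ‖y - p‖⁻¹ • (y - p) with hv
  have hvs : v ∈ sphere (0 : Euc d) 1 := by
    rw [mem_sphere_zero_iff_norm, hv, norm_smul, norm_inv, norm_norm, inv_mul_cancel₀ hpos.ne']
  obtain ⟨u, hu, huv⟩ := hs v hvs
  obtain ⟨i, hi⟩ := hhit u hu
  have hyp : ⟪v, y - p⟫ = ‖y - p‖ := by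
    rw [hv, real_inner_smul_left, real_inner_self_eq_norm_sq]
    field_simp
  have hXp : ⟪v, X i - p⟫ ≤ 0 := by
    rw [hv, real_inner_smul_left]
    exact mul_nonpos_of_nonneg_of_nonpos (by positivity)
      (hmin _ (subset_convexHull ℝ _ ⟨i, rfl⟩))
  have hdiam : ‖y - X i‖ ≤ 2 := by
    have h1 := mem_closedBall_zero_iff.1 (hball hy)
    have h2 := mem_closedBall_zero_iff.1 (hball (hX i))
    linarith [norm_sub_le y (X i)]
  have hcs : ⟪v - u, y - X i⟫ ≤ ε / 2 * 2 :=
    (real_inner_le_norm _ _).trans (mul_le_mul huv hdiam (norm_nonneg _) (by positivity))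
  have hsup := inner_le_suppFn hG u hy
  have hcap := hi.2
  simp only [inner_sub_left, inner_sub_right] at hyp hXp hcs
  linarith

/-- Union bound: an i.i.d. sample hits finitely many sets of mass at least `q` with probability at
least `1 - N * exp (-n * q)`. -/
lemma ofReal_le_pi_of_hits {E : Type*} [MeasurableSpace E] (μ : Measure E) [IsProbabilityMeasure μ]
    {n : ℕ} {κ : Type*} (s : Finset κ) (A : κ → Set E) (hA : ∀ u ∈ s, MeasurableSet (A u))
    {q : ℝ} (hq : ∀ u ∈ s, ENNReal.ofReal q ≤ μ (A u)) {G : Set E}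
    (hG : μ G = 1) :
    ENNReal.ofReal (1 - s.card * Real.exp (-(n * q))) ≤
      Measure.pi (fun _ : Fin n => μ)
        {ω | (∀ i, ω i ∈ G) ∧ ∀ u ∈ s, ∃ i, ω i ∈ A u} := by
  set P := Measure.pi (fun _ : Fin n => μ) with hP
  set B : Set (Fin n → E) := ⋃ u ∈ s, Set.univ.pi fun _ => (A u)ᶜ with hB
  set F : Set (Fin n → E) := Set.univ.pi fun _ => G with hF
  have hPF : P F = 1 := by simp [hP, hF, Measure.pi_pi, hG]
  have hPB : P B ≤ ENNReal.ofReal (s.card * Real.exp (-(n * q))) := by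
    have hone : ∀ u ∈ s, P (Set.univ.pi fun _ => (A u)ᶜ) ≤ ENNReal.ofReal (Real.exp (-(n * q))) := by
      intro u hu
      have hc : μ (A u)ᶜ ≤ ENNReal.ofReal (Real.exp (-q)) := by
        rw [prob_compl_eq_one_sub (hA u hu)]
        refine (tsub_le_tsub_left (hq u hu) 1).trans ?_
        rw [tsub_le_iff_right]
        rcases le_or_gt 0 q with h0 | h0
        · rw [← ENNReal.ofReal_add (Real.exp_pos _).le h0, ← ENNReal.ofReal_one]
          exact ENNReal.ofReal_le_ofReal (by linarith [Real.add_one_le_exp (-q)])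
        · refine le_add_right ?_
          rw [← ENNReal.ofReal_one]
          exact ENNReal.ofReal_le_ofReal (Real.one_le_exp (by linarith))
      rw [hP, Measure.pi_pi, Finset.prod_const, Finset.card_univ, Fintype.card_fin,
        show -((n : ℝ) * q) = n * (-q) by ring, Real.exp_nat_mul,
        ENNReal.ofReal_pow (Real.exp_pos _).le]
      gcongr
    calc P B ≤ ∑ u ∈ s, P (Set.univ.pi fun _ => (A u)ᶜ) := measure_biUnion_finset_le _ _
      _ ≤ ∑ _u ∈ s, ENNReal.ofReal (Real.exp (-(n * q))) := Finset.sum_le_sum hone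
      _ = ENNReal.ofReal (s.card * Real.exp (-(n * q))) := by
        rw [Finset.sum_const, nsmul_eq_mul, ENNReal.ofReal_mul (by positivity),
          ENNReal.ofReal_natCast]
  have hsub : F \ B ⊆ {ω | (∀ i, ω i ∈ G) ∧ ∀ u ∈ s, ∃ i, ω i ∈ A u} := by
    intro ω hω
    simpa [hF, hB] using hω
  refine le_trans ?_ (measure_mono hsub)
  rw [ENNReal.ofReal_sub _ (by positivity), ENNReal.ofReal_one, ← hPF]
  exact (tsub_le_tsub_left hPB _).trans (le_measure_sdiff)

lemma mul_rpow_add_rpow_le_add_rpow {α a b : ℝ} (hα : 0 < α) (ha : 0 ≤ a) (hb : 0 ≤ b) :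
    (if 1 ≤ α then (1 : ℝ) else 2 ^ (α - 1)) * (a ^ α + b ^ α) ≤ (a + b) ^ α := by
  split_ifs with h
  · rw [one_mul]
    exact Real.add_rpow_le_rpow_add ha hb h
  · have hc := (Real.concaveOn_rpow hα.le (not_le.1 h).le).2 (Set.mem_Ici.2 ha) (Set.mem_Ici.2 hb)
      (by norm_num : (0 : ℝ) ≤ 1 / 2) (by norm_num : (0 : ℝ) ≤ 1 / 2) (by norm_num)
    simp only [smul_eq_mul] at hc
    rw [← mul_add, ← mul_add, Real.mul_rpow (by norm_num) (by positivity),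
      one_div, Real.inv_rpow (by norm_num)] at hc
    rw [Real.rpow_sub_one (by norm_num)]
    have h2 : (0 : ℝ) < 2 ^ α := by positivity
    calc (2 : ℝ) ^ α / 2 * (a ^ α + b ^ α) = 2 ^ α * (2⁻¹ * (a ^ α + b ^ α)) := by ring
      _ ≤ 2 ^ α * ((2 ^ α)⁻¹ * (a + b) ^ α) := by gcongr
      _ = (a + b) ^ α := by field_simp

/-- The tail estimate balancing the cardinality of the net against the exponential bound. -/
lemma net_card_mul_exp_le {d n : ℕ} {L α τ C ε x N : ℝ} (hn : 2 ≤ n) (hL : 0 < L) (hα : 0 < α)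
    (hx : 0 ≤ x) (hτ : 0 < τ) (hC : 2 ≤ C) (hC' : d / α ≤ τ * L * C)
    (hτε : ∀ a b : ℝ, 0 ≤ a → 0 ≤ b → τ * (a ^ α + b ^ α) ≤ (a + b) ^ α)
    (hε : ε = (C * Real.log n / n) ^ (1 / α) + (n : ℝ) ^ (-(1 : ℝ) / α) * x) (hε1 : ε ≤ 1)
    (hN : N ≤ (1 + 2 / (ε / 2)) ^ d) :
    N * Real.exp (-(n * (L * ε ^ α))) ≤ 12 ^ d * Real.exp (-τ * L * x ^ α) := by
  have hn0 : (0 : ℝ) < n := by positivity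
  have hlog2 : Real.log 2 ≤ Real.log n := Real.log_le_log (by norm_num) (by exact_mod_cast hn)
  have hlog : 1 / 2 ≤ Real.log n := by linarith [Real.log_two_gt_d9]
  have hClog : 1 ≤ C * Real.log n := by nlinarith
  have ha0 : 0 ≤ C * Real.log n / n := by positivity
  have hpow : ((n : ℝ) ^ (1 / α))⁻¹ ≤ ε := by
    rw [← Real.inv_rpow hn0.le, hε]
    have h1 : (n : ℝ)⁻¹ ≤ C * Real.log n / n := by
      rw [inv_eq_one_div]
      gcongr
    have h2 := Real.rpow_le_rpow (by positivity) h1 (by positivity : 0 ≤ 1 / α)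
    have h3 : 0 ≤ (n : ℝ) ^ (-(1 : ℝ) / α) * x := by positivity
    linarith
  have hεpos : 0 < ε := lt_of_lt_of_le (by positivity) hpow
  have hinv : 1 / ε ≤ (n : ℝ) ^ (1 / α) := by
    rw [one_div]
    exact inv_le_of_inv_le₀ (by positivity) hpow
  have hbase : 1 + 2 / (ε / 2) ≤ 12 * (n : ℝ) ^ (1 / α) := by
    have h1 : 1 ≤ 1 / ε := (one_le_div hεpos).2 hε1
    have h2 : 2 / (ε / 2) = 4 * (1 / ε) := by field_simp; norm_num
    rw [h2]
    linarith
  have hcard : N ≤ 12 ^ d * Real.exp (d / α * Real.log n) := by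
    refine hN.trans ((pow_le_pow_left₀ (by positivity) hbase d).trans_eq ?_)
    rw [mul_pow, ← Real.rpow_natCast (_ ^ _), ← Real.rpow_mul hn0.le, Real.rpow_def_of_pos hn0]
    congr 2
    ring
  have hexp : τ * L * C * Real.log n + τ * L * x ^ α ≤ n * (L * ε ^ α) := by
    have h := hτε _ _ (Real.rpow_nonneg ha0 (1 / α))
      (by positivity : 0 ≤ (n : ℝ) ^ (-(1 : ℝ) / α) * x)
    rw [← hε, Real.mul_rpow (by positivity) hx, ← Real.rpow_mul ha0, ← Real.rpow_mul hn0.le,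
      one_div_mul_cancel hα.ne', div_mul_cancel₀ _ hα.ne', Real.rpow_one, Real.rpow_neg_one] at h
    calc τ * L * C * Real.log n + τ * L * x ^ α
        = n * (L * (τ * (C * Real.log n / n + (n : ℝ)⁻¹ * x ^ α))) := by field_simp
      _ ≤ n * (L * ε ^ α) := by gcongr
  calc N * Real.exp (-(n * (L * ε ^ α)))
      ≤ 12 ^ d * Real.exp (d / α * Real.log n) *
          Real.exp (-(τ * L * C * Real.log n + τ * L * x ^ α)) := by gcongr
    _ = 12 ^ d * Real.exp (d / α * Real.log n - (τ * L * C * Real.log n + τ * L * x ^ α)) := by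
      rw [mul_assoc, ← Real.exp_add, sub_eq_add_neg]
    _ ≤ 12 ^ d * Real.exp (-τ * L * x ^ α) := by
      have := mul_le_mul_of_nonneg_right hC' (by linarith : 0 ≤ Real.log n)
      gcongr
      linarith

/-- Hausdorff deviation inequality for the convex hull of an i.i.d. sample whose distribution
puts mass at least `L·t^α` on every cap of height `t ≤ r` of its convex support `G ⊆ B(0,1)`. -/
theorem convex_hull_hausdorff_deviation (d : ℕ) (hd : 1 ≤ d)
    (r L α : ℝ) (hr0 : 0 < r) (hr1 : r < 1) (hL : 0 < L) (hα : 0 < α) :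
    ∃ C : ℝ, 0 < C ∧
      ∀ n : ℕ, 1 ≤ n →
        ∀ G : Set (Euc d),
          (IsCompact G ∧ Convex ℝ G ∧ (interior G).Nonempty) →
          G ⊆ closedBall (0 : Euc d) 1 →
          ∀ μ : Measure (Euc d), ∀ _ : IsProbabilityMeasure μ, μ G = 1 →
            (∀ u ∈ sphere (0 : Euc d) 1, ∀ t ∈ Set.Icc (0 : ℝ) r,
              ENNReal.ofReal (L * t ^ α) ≤ μ (cap G u t)) →
            ∀ x : ℝ, 0 ≤ x →
              (C * Real.log n / n) ^ (1 / α) + (n : ℝ) ^ (-(1 : ℝ) / α) * x ≤ r →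
              ENNReal.ofReal
                  (1 - 12 ^ d * Real.exp
                    (-(if 1 ≤ α then (1 : ℝ) else 2 ^ (α - 1)) * L * x ^ α)) ≤
                Measure.pi (fun _ : Fin n => μ)
                  {ω | hausdorffDist (convexHull ℝ (Set.range ω)) G ≤
                    2 * (C * Real.log n / n) ^ (1 / α) +
                      2 * (n : ℝ) ^ (-(1 : ℝ) / α) * x} := by
  set τ : ℝ := if 1 ≤ α then (1 : ℝ) else 2 ^ (α - 1) with hτdef
  have hτ : 0 < τ := by
    rw [hτdef]
    split_ifs <;> positivity
  have hτ1 : τ ≤ 1 := by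
    rw [hτdef]
    split_ifs with h
    · exact le_rfl
    · exact Real.rpow_le_one_of_one_le_of_nonpos one_le_two (by linarith)
  refine ⟨2 + d / (α * (τ * L)), by positivity, ?_⟩
  set C : ℝ := 2 + d / (α * (τ * L)) with hC
  have hC2 : 2 ≤ C := le_add_of_nonneg_right (by positivity)
  have hC' : d / α ≤ τ * L * C := by
    have h : τ * L * C = 2 * (τ * L) + d / α := by
      rw [hC]
      field_simp
    rw [h]
    exact le_add_of_nonneg_left (by positivity)
  intro n hn G hG hball μ _ hμG hmass x hx hr
  obtain ⟨hGc, hGconv, -⟩ := hG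
  rcases hn.eq_or_lt with rfl | hn2
  · have hxr : x ≤ r := by
      have h0 : (0 : ℝ) ^ α⁻¹ = 0 := Real.zero_rpow (inv_ne_zero hα.ne')
      simpa [h0] using hr
    have hle : L * x ^ α ≤ 1 := by
      have hu : EuclideanSpace.single (⟨0, hd⟩ : Fin d) (1 : ℝ) ∈ sphere (0 : Euc d) 1 := by
        simp
      have h := (hmass _ hu x ⟨hx, hxr⟩).trans prob_le_one
      rwa [ENNReal.ofReal_le_one] at h
    have hexp : Real.exp (-1) ≤ Real.exp (-τ * L * x ^ α) := by
      have h0 : 0 ≤ L * x ^ α := by positivity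
      have := mul_le_one₀ hτ1 h0 hle
      gcongr
      linarith
    have h12 : (12 : ℝ) ≤ 12 ^ d := le_self_pow₀ (by norm_num) (by omega)
    have he : 1 / 12 ≤ Real.exp (-1) := by linarith [Real.exp_neg_one_gt_d9]
    rw [ENNReal.ofReal_of_nonpos]
    · exact zero_le
    · nlinarith
  · set ε : ℝ := (C * Real.log n / n) ^ (1 / α) + (n : ℝ) ^ (-(1 : ℝ) / α) * x with hε
    have hlog : 0 < Real.log n := Real.log_pos (by exact_mod_cast hn2)
    have hn0 : (0 : ℝ) < n := by positivity
    have hεpos : 0 < ε := by positivity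
    obtain ⟨s, hs, hcover, hcard⟩ := exists_sphere_net d (half_pos hεpos)
    have hprob := ofReal_le_pi_of_hits μ (n := n) s (fun u => cap G u ε)
      (fun u _ => (isClosed_cap hGc u ε).measurableSet)
      (fun u hu => hmass u (hs u hu) ε ⟨hεpos.le, hr⟩) hμG
    have htail := net_card_mul_exp_le hn2 hL hα hx hτ hC2 hC'
      (fun a b ha hb => mul_rpow_add_rpow_le_add_rpow hα ha hb) hε (hr.trans hr1.le) hcard
    refine (ENNReal.ofReal_le_ofReal (sub_le_sub_left htail 1)).trans
      (hprob.trans (measure_mono ?_))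
    rintro ω ⟨hωG, hωcap⟩
    have : Nonempty (Fin n) := ⟨⟨0, hn⟩⟩
    have h := hausdorffDist_convexHull_le_of_hits_caps hGc hGconv hball hεpos s hcover ω hωG hωcap
    rw [hε, mul_add, ← mul_assoc] at h
    exact h
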